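/- arXiv:1911.13167 — 2 statements merged into one kernel-verified Lean document; each statement's English description precedes it below -/
import Mathlib

section
/- There exist constants α > 0 and C < ∞, depending only on β, c₁ and c₂ (and in particular independent of l and τ₀), such that for every integer l ≥ 1 and every τ₀ ∈ ℝ the block average of the forces satisfies the uniform exponential square-moment bound ∫_{ℝ^l} exp( α l ( (1/l) Σ_{j=1}^{l} V'(r_j) − τ₀ )² ) dλ^l_{β,τ₀} ≤ C. -/
open MeasureTheory Real Set Finset
open scoped ENNReal

/-- The canonical Gibbs function `G(τ) = log ∫ exp(-βV(r) + βτr) dr`. -/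
noncomputable def gibbsG (β : ℝ) (V : ℝ → ℝ) (τ : ℝ) : ℝ :=
  Real.log (∫ r : ℝ, Real.exp (-β * V r + β * τ * r))

/-- One-site Gibbs density `exp(-βV(r) + βτr - G(τ))`. -/
noncomputable def gibbsDensity (β : ℝ) (V : ℝ → ℝ) (τ r : ℝ) : ℝ :=
  Real.exp (-β * V r + β * τ * r - gibbsG β V τ)

/-- The `l`-fold product Gibbs measure `λ^l_{β,τ}` on `ℝ^l`. -/
noncomputable def gibbsPi (β : ℝ) (V : ℝ → ℝ) (τ : ℝ) (l : ℕ) : Measure (Fin l → ℝ) :=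
  volume.withDensity fun x => ENNReal.ofReal (∏ i, gibbsDensity β V τ (x i))

/-- Quadratic lower bound for a function whose second derivative is at least `c`. -/
theorem quadratic_lower_bound {f f' : ℝ → ℝ} {c : ℝ} (hf : ∀ x, HasDerivAt f (f' x) x)
    (hc : Monotone fun x => f' x - c * x) (x y : ℝ) :
    f x + f' x * (y - x) + c / 2 * (y - x) ^ 2 ≤ f y := by
  have hg : ∀ t, HasDerivAt (fun t => f t - f' x * (t - x) - c / 2 * (t - x) ^ 2)
      (f' t - f' x - c * (t - x)) t := fun t => by
    have h := (hasDerivAt_id t).sub_const x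
    convert! ((hf t).sub (h.const_mul (f' x))).sub ((h.pow 2).const_mul (c / 2)) using 1
    simp
    ring
  have hconv : ConvexOn ℝ univ (fun t => f t - f' x * (t - x) - c / 2 * (t - x) ^ 2) := by
    refine Monotone.convexOn_univ_of_deriv (fun t => (hg t).differentiableAt) ?_
    intro a b hab
    rw [(hg a).deriv, (hg b).deriv]
    have := hc hab
    simp only at this
    linarith
  have hx : HasDerivAt (fun t => f t - f' x * (t - x) - c / 2 * (t - x) ^ 2) 0 x := by
    simpa using hg x
  rcases lt_trichotomy x y with h | rfl | h
  · have := hconv.le_slope_of_hasDerivAt (mem_univ x) (mem_univ y) h hx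
    rw [slope_def_field, le_div_iff₀ (sub_pos.2 h)] at this
    simp at this
    linarith
  · simp
  · have := hconv.slope_le_of_hasDerivAt (mem_univ y) (mem_univ x) h hx
    rw [slope_def_field, div_le_iff₀ (sub_pos.2 h)] at this
    simp at this
    linarith

/-- Quadratic upper bound for a function whose second derivative is at most `c`. -/
theorem quadratic_upper_bound {f f' : ℝ → ℝ} {c : ℝ} (hf : ∀ x, HasDerivAt f (f' x) x)
    (hc : Antitone fun x => f' x - c * x) (x y : ℝ) :
    f y ≤ f x + f' x * (y - x) + c / 2 * (y - x) ^ 2 := by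
  have h := quadratic_lower_bound (f := fun t => -f t) (f' := fun t => -f' t) (c := -c)
    (fun t => (hf t).neg) (fun a b hab => by have := hc hab; simp only at this ⊢; linarith) x y
  linarith

theorem integrable_exp_gibbs {β c : ℝ} (hβ : 0 < β) (hc : 0 < c) {V V' : ℝ → ℝ}
    (hV : ∀ x, HasDerivAt V (V' x) x) (hmono : Monotone fun x => V' x - c * x) (τ : ℝ) :
    Integrable fun r => Real.exp (-β * V r + β * τ * r) := by
  have hcont : Continuous V := continuous_iff_continuousAt.2 fun x => (hV x).continuousAt
  have hb : 0 < β * c / 4 := by positivity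
  refine ((integrable_exp_neg_mul_sq hb).const_mul
    (Real.exp (-β * V 0 + β * (τ - V' 0) ^ 2 / c))).mono' (by fun_prop) (.of_forall fun r => ?_)
  rw [Real.norm_of_nonneg (exp_pos _).le, ← Real.exp_add, Real.exp_le_exp]
  have h1 := mul_le_mul_of_nonneg_left (quadratic_lower_bound hV hmono 0 r) hβ.le
  have h2 : 0 ≤ β * c * (r / 2 - (τ - V' 0) / c) ^ 2 := by positivity
  have h3 : β * c * (r / 2 - (τ - V' 0) / c) ^ 2
      = β * c / 4 * r ^ 2 - β * (τ - V' 0) * r + β * (τ - V' 0) ^ 2 / c := by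
    field_simp
    ring
  linarith

theorem gibbsDensity_pos (β : ℝ) (V : ℝ → ℝ) (τ r : ℝ) : 0 < gibbsDensity β V τ r :=
  exp_pos _

theorem continuous_gibbsDensity (β : ℝ) {V : ℝ → ℝ} (hV : Continuous V) (τ : ℝ) :
    Continuous (gibbsDensity β V τ) := by
  unfold gibbsDensity
  fun_prop

theorem gibbsDensity_eq_div {β τ : ℝ} {V : ℝ → ℝ}
    (h : Integrable fun r => Real.exp (-β * V r + β * τ * r)) (r : ℝ) :
    gibbsDensity β V τ r
      = Real.exp (-β * V r + β * τ * r) / ∫ r : ℝ, Real.exp (-β * V r + β * τ * r) := by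
  rw [gibbsDensity, gibbsG, Real.exp_sub, Real.exp_log (integral_exp_pos h)]

theorem lintegral_prod_gibbsDensity {β τ : ℝ} {V : ℝ → ℝ}
    (h : Integrable fun r => Real.exp (-β * V r + β * τ * r)) (l : ℕ) :
    ∫⁻ x : Fin l → ℝ, ENNReal.ofReal (∏ i, gibbsDensity β V τ (x i)) = 1 := by
  have hint : Integrable (gibbsDensity β V τ) := by
    simpa only [← gibbsDensity_eq_div h] using
      h.div_const (∫ r : ℝ, Real.exp (-β * V r + β * τ * r))
  have hone : ∫ r, gibbsDensity β V τ r = 1 := by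
    simp_rw [gibbsDensity_eq_div h]
    rw [integral_div, div_self (integral_exp_pos h).ne']
  have hprod : Integrable fun x : Fin l → ℝ => ∏ i, gibbsDensity β V τ (x i) :=
    Integrable.fintype_prod fun _ => hint
  rw [← ofReal_integral_eq_lintegral_ofReal hprod
    (.of_forall fun x => prod_nonneg fun i _ => (gibbsDensity_pos β V τ (x i)).le),
    integral_fintype_prod_volume_eq_pow, hone]
  simp

theorem isProbabilityMeasure_gibbsPi {β τ : ℝ} {V : ℝ → ℝ}
    (h : Integrable fun r => Real.exp (-β * V r + β * τ * r)) (l : ℕ) :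
    IsProbabilityMeasure (gibbsPi β V τ l) :=
  ⟨by rw [gibbsPi, withDensity_apply _ MeasurableSet.univ, Measure.restrict_univ,
    lintegral_prod_gibbsDensity h]⟩

/-- Translating the Gibbs density dominates its exponential tilt by the force. -/
theorem exp_force_mul_gibbsDensity_le {β c : ℝ} (hβ : 0 < β) {V V' : ℝ → ℝ}
    (hV : ∀ x, HasDerivAt V (V' x) x) (hanti : Antitone fun x => V' x - c * x) (τ h r : ℝ) :
    Real.exp (h * β * (V' r - τ)) * gibbsDensity β V τ r
      ≤ Real.exp (β * c * h ^ 2 / 2) * gibbsDensity β V τ (r - h) := by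
  rw [gibbsDensity, gibbsDensity, ← Real.exp_add, ← Real.exp_add, Real.exp_le_exp]
  have := mul_le_mul_of_nonneg_left (quadratic_upper_bound hV hanti r (r - h)) hβ.le
  linarith

/-- Sub-Gaussian bound for the sum of the centred forces. -/
theorem lintegral_exp_sum_force_le {β c : ℝ} (hβ : 0 < β) {V V' : ℝ → ℝ}
    (hV : ∀ x, HasDerivAt V (V' x) x) (hV' : Continuous V')
    (hanti : Antitone fun x => V' x - c * x) {τ : ℝ}
    (hint : Integrable fun r => Real.exp (-β * V r + β * τ * r)) (l : ℕ) (h : ℝ) :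
    ∫⁻ x, ENNReal.ofReal (Real.exp (h * β * ∑ j, (V' (x j) - τ))) ∂(gibbsPi β V τ l)
      ≤ ENNReal.ofReal (Real.exp (l * (β * c * h ^ 2 / 2))) := by
  have hcont : Continuous V := continuous_iff_continuousAt.2 fun x => (hV x).continuousAt
  have hd := continuous_gibbsDensity β hcont τ
  rw [gibbsPi, lintegral_withDensity_eq_lintegral_mul _
    (Continuous.measurable (by fun_prop)).ennreal_ofReal
    (Continuous.measurable (by fun_prop)).ennreal_ofReal]
  calc _ ≤ ∫⁻ x : Fin l → ℝ, ENNReal.ofReal (Real.exp (l * (β * c * h ^ 2 / 2))) *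
        ENNReal.ofReal (∏ i, gibbsDensity β V τ ((x - fun _ : Fin l => h) i)) := by
        refine lintegral_mono fun x => ?_
        simp only [Pi.mul_apply, Pi.sub_apply]
        rw [mul_comm, ← ENNReal.ofReal_mul (exp_pos _).le, ← ENNReal.ofReal_mul (exp_pos _).le]
        refine ENNReal.ofReal_le_ofReal ?_
        have key := Finset.prod_le_prod (s := Finset.univ)
          (fun (i : Fin l) _ => (mul_pos (exp_pos (h * β * (V' (x i) - τ)))
            (gibbsDensity_pos β V τ (x i))).le)
          (fun i _ => exp_force_mul_gibbsDensity_le hβ hV hanti τ h (x i))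
        rw [prod_mul_distrib, prod_mul_distrib, ← Real.exp_sum, ← Finset.mul_sum, prod_const,
          ← Real.exp_nat_mul] at key
        simpa using key
    _ = _ := by
        rw [lintegral_const_mul' _ _ ENNReal.ofReal_ne_top,
          lintegral_sub_right_eq_self
            (fun x : Fin l → ℝ => ENNReal.ofReal (∏ i, gibbsDensity β V τ (x i))),
          lintegral_prod_gibbsDensity hint, mul_one]

theorem lintegral_exp_neg_mul_sq {b : ℝ} (hb : 0 < b) :
    ∫⁻ h : ℝ, ENNReal.ofReal (Real.exp (-b * h ^ 2)) = ENNReal.ofReal (√(π / b)) := by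
  rw [← ofReal_integral_eq_lintegral_ofReal (integrable_exp_neg_mul_sq hb)
    (.of_forall fun _ => (exp_pos _).le), integral_gaussian]

/-- Laplace transform of the Gaussian weight `exp (-b h²)`. -/
theorem lintegral_exp_mul_sub_mul_sq {b : ℝ} (hb : 0 < b) (y : ℝ) :
    ∫⁻ h : ℝ, ENNReal.ofReal (Real.exp (-b * h ^ 2)) * ENNReal.ofReal (Real.exp (h * y))
      = ENNReal.ofReal (√(π / b)) * ENNReal.ofReal (Real.exp (y ^ 2 / (4 * b))) := by
  have hsq : ∀ h : ℝ,
      ENNReal.ofReal (Real.exp (-b * h ^ 2)) * ENNReal.ofReal (Real.exp (h * y))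
      = ENNReal.ofReal (Real.exp (-b * (h - y / (2 * b)) ^ 2))
        * ENNReal.ofReal (Real.exp (y ^ 2 / (4 * b))) := fun h => by
    rw [← ENNReal.ofReal_mul (exp_pos _).le, ← ENNReal.ofReal_mul (exp_pos _).le,
      ← Real.exp_add, ← Real.exp_add]
    congr 2
    field_simp
    ring
  simp_rw [hsq]
  rw [lintegral_mul_const' _ _ ENNReal.ofReal_ne_top,
    lintegral_sub_right_eq_self (fun h : ℝ => ENNReal.ofReal (Real.exp (-b * h ^ 2))),
    lintegral_exp_neg_mul_sq hb]

/-- A sub-Gaussian variable has a bounded exponential square moment. -/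
theorem lintegral_exp_sq_le_sqrt_two {Ω : Type*} [MeasurableSpace Ω] {μ : Measure Ω} [SFinite μ]
    {b : ℝ} (hb : 0 < b) {Y : Ω → ℝ} (hY : Measurable Y)
    (hsub : ∀ h : ℝ, ∫⁻ x, ENNReal.ofReal (Real.exp (h * Y x)) ∂μ
      ≤ ENNReal.ofReal (Real.exp (b / 2 * h ^ 2))) :
    ∫⁻ x, ENNReal.ofReal (Real.exp (Y x ^ 2 / (4 * b))) ∂μ ≤ ENNReal.ofReal √2 := by
  have hpos : 0 < √(π / b) := Real.sqrt_pos.2 (by positivity)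
  rw [← ENNReal.mul_le_mul_iff_right (a := ENNReal.ofReal (√(π / b)))
    (by simpa using hpos) ENNReal.ofReal_ne_top,
    ← lintegral_const_mul' _ _ ENNReal.ofReal_ne_top]
  simp_rw [← lintegral_exp_mul_sub_mul_sq hb]
  rw [lintegral_lintegral_swap (by
    refine Measurable.aemeasurable ?_
    unfold Function.uncurry
    fun_prop)]
  calc _ ≤ ∫⁻ h : ℝ, ENNReal.ofReal (Real.exp (-(b / 2) * h ^ 2)) := by
        refine lintegral_mono fun h => ?_
        rw [lintegral_const_mul' _ _ ENNReal.ofReal_ne_top]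
        refine (mul_le_mul_right (hsub h) _).trans_eq ?_
        rw [← ENNReal.ofReal_mul (exp_pos _).le, ← Real.exp_add]
        ring_nf
    _ = _ := by
        rw [lintegral_exp_neg_mul_sq (by positivity), ← ENNReal.ofReal_mul hpos.le,
          ← Real.sqrt_mul (by positivity)]
        congr 2
        field_simp

/-- There exist `α > 0` and `C < ∞`, depending only on `β, c₁, c₂`
(in particular independent of `l` and `τ₀`), such that for every `l ≥ 1` and every `τ₀`,
`∫ exp(α l ((1/l) Σⱼ V'(rⱼ) - τ₀)²) dλ^l_{β,τ₀} ≤ C`. -/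
theorem uniform_exponential_moment_force_average
    (β c₁ c₂ : ℝ) (hβ : 0 < β) (hc₁ : 0 < c₁) (hc₁₂ : c₁ ≤ c₂) :
    ∃ α C : ℝ, 0 < α ∧ 0 < C ∧
      ∀ (V : ℝ → ℝ), ContDiff ℝ 2 V →
        (∀ r : ℝ, c₁ ≤ deriv (deriv V) r ∧ deriv (deriv V) r ≤ c₂) →
      ∀ (l : ℕ), 1 ≤ l → ∀ τ₀ : ℝ,
        (∫⁻ x, ENNReal.ofReal
            (Real.exp (α * l * ((1 / (l : ℝ)) * (∑ j, deriv V (x j)) - τ₀) ^ 2))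
            ∂(gibbsPi β V τ₀ l)) ≤ ENNReal.ofReal C := by
  have hc₂ : 0 < c₂ := hc₁.trans_le hc₁₂
  refine ⟨β / (4 * c₂), √2, by positivity, by positivity, fun V hV hV'' l hl τ₀ => ?_⟩
  have hdV : ∀ x, HasDerivAt V (deriv V x) x := fun x =>
    (hV.differentiable (by norm_num) x).hasDerivAt
  have hV' : ContDiff ℝ 1 (deriv V) := hV.deriv'
  have hd2 : ∀ c x, HasDerivAt (fun x => deriv V x - c * x) (deriv (deriv V) x - c) x :=
    fun c x => by
      simpa using ((hV'.differentiable (by norm_num) x).hasDerivAt).fun_sub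
        ((hasDerivAt_id x).const_mul c)
  have hmono : Monotone fun x => deriv V x - c₁ * x :=
    monotone_of_deriv_nonneg (fun x => (hd2 c₁ x).differentiableAt) fun x => by
      rw [(hd2 c₁ x).deriv]
      linarith [(hV'' x).1]
  have hanti : Antitone fun x => deriv V x - c₂ * x :=
    antitone_of_deriv_nonpos (fun x => (hd2 c₂ x).differentiableAt) fun x => by
      rw [(hd2 c₂ x).deriv]
      linarith [(hV'' x).2]
  have hint := integrable_exp_gibbs hβ hc₁ hdV hmono τ₀
  have := isProbabilityMeasure_gibbsPi hint l
  have hl' : (0 : ℝ) < l := by exact_mod_cast hl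
  have hcont := hV'.continuous
  have hsub := lintegral_exp_sq_le_sqrt_two (μ := gibbsPi β V τ₀ l) (b := l * (β * c₂))
    (by positivity) (Y := fun x => β * ∑ j, (deriv V (x j) - τ₀))
    (Continuous.measurable (by fun_prop)) fun h => by
      have := lintegral_exp_sum_force_le hβ hdV hcont hanti hint l h
      simp_rw [mul_assoc h β] at this
      refine this.trans_eq ?_
      ring_nf
  refine (lintegral_congr fun x => ?_).trans_le hsub
  rw [Finset.sum_sub_distrib]
  simp only [sum_const, card_univ, Fintype.card_fin, nsmul_eq_mul]
  congr 2
  field_simp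
end

section
/- Let φ : [0,1] → ℝ be continuously differentiable. There exists a constant C, depending only on sup|φ| and sup|φ'|, such that for all integers N ≥ 3 and 1 ≤ l with 2l+1 ≤ N, and every u ∈ ℝ^N: | ∫_0^1 û_N(x) φ(x) dx − (1/N) Σ_{i=1}^N u_i φ(i/N) | ≤ C √(l/N) · ( (1/N) Σ_{i=1}^N u_i² )^{1/2}, where û_N(x) := Σ_{i=l+1}^{N−l} 1_{N,i}(x) û_{l,i}, with 1_{N,i} the indicator function of the interval [ i/N − 1/(2N), i/N + 1/(2N) ] and û_{l,i} := (1/l) Σ_{|j|<l} ((l−|j|)/l) u_{i−j} the smoothed block average. -/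
open MeasureTheory Real Set Finset

/-- Smoothed block average `û_{l,i} = (1/l) Σ_{|j|<l} ((l-|j|)/l) u_{i-j}`
of a (1-indexed) sequence `u : ℕ → ℝ`. -/
noncomputable def smoothBlockAvg (u : ℕ → ℝ) (l i : ℕ) : ℝ :=
  (1 / (l : ℝ)) * ∑ j ∈ Finset.Ioo (-(l : ℤ)) (l : ℤ),
    (((l : ℝ) - |(j : ℝ)|) / (l : ℝ)) * u ((i - j : ℤ)).toNat

/-- The piecewise-constant profile `û_N(x) = Σ_{i=l+1}^{N-l} 1_{N,i}(x) û_{l,i}`,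
where `1_{N,i}` is the indicator of `[i/N - 1/(2N), i/N + 1/(2N)]`. -/
noncomputable def smoothProfile (u : ℕ → ℝ) (N l : ℕ) (x : ℝ) : ℝ :=
  ∑ i ∈ Finset.Icc (l + 1) (N - l),
    Set.indicator (Set.Icc ((i : ℝ) / N - 1 / (2 * N)) ((i : ℝ) / N + 1 / (2 * N)))
      (fun _ => smoothBlockAvg u l i) x

/-- Partial sums of the (unnormalised) triangular weight `m - |j|`. -/
theorem sum_Ioo_sub_abs (m : ℝ) (n : ℕ) :
    ∑ j ∈ Finset.Ioo (-((n + 1 : ℕ) : ℤ)) ((n + 1 : ℕ) : ℤ), (m - |(j : ℝ)|)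
      = m * (2 * n + 1) - n * (n + 1) := by
  induction n with
  | zero =>
    have : Finset.Ioo (-((0 + 1 : ℕ) : ℤ)) ((0 + 1 : ℕ) : ℤ) = {0} := by
      ext j; simp only [Finset.mem_Ioo, Finset.mem_singleton]; omega
    rw [this]; simp
  | succ n ih =>
    have hset : Finset.Ioo (-((n + 1 + 1 : ℕ) : ℤ)) ((n + 1 + 1 : ℕ) : ℤ) =
        insert (-((n + 1 : ℕ) : ℤ)) (insert ((n + 1 : ℕ) : ℤ)
          (Finset.Ioo (-((n + 1 : ℕ) : ℤ)) ((n + 1 : ℕ) : ℤ))) := by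
      ext j; simp only [Finset.mem_Ioo, Finset.mem_insert]; omega
    rw [hset, Finset.sum_insert, Finset.sum_insert, ih]
    · have h : |((n : ℝ) + 1)| = n + 1 := abs_of_nonneg (by positivity)
      push_cast
      rw [abs_neg, h]
      ring
    · simp
    · simp only [Finset.mem_insert, Finset.mem_Ioo]; omega

/-- The normalised triangular weights defining the block average. -/
noncomputable def triangularWeight (l : ℕ) (j : ℤ) : ℝ :=
  (1 / (l : ℝ)) * (((l : ℝ) - |(j : ℝ)|) / (l : ℝ))

theorem triangularWeight_nonneg {l : ℕ} {j : ℤ} (hj : j ∈ Finset.Ioo (-(l : ℤ)) (l : ℤ)) :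
    0 ≤ triangularWeight l j := by
  rw [Finset.mem_Ioo] at hj
  have h : |(j : ℝ)| ≤ l := by
    rw [abs_le]
    exact ⟨by exact_mod_cast hj.1.le, by exact_mod_cast hj.2.le⟩
  have : 0 ≤ (l : ℝ) - |(j : ℝ)| := sub_nonneg.2 h
  unfold triangularWeight
  positivity

theorem sum_triangularWeight {l : ℕ} (hl : 1 ≤ l) :
    ∑ j ∈ Finset.Ioo (-(l : ℤ)) (l : ℤ), triangularWeight l j = 1 := by
  obtain ⟨n, rfl⟩ : ∃ n, l = n + 1 := ⟨l - 1, by omega⟩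
  unfold triangularWeight
  rw [← Finset.mul_sum, ← Finset.sum_div, sum_Ioo_sub_abs]
  have : ((n : ℝ) + 1) ≠ 0 := by positivity
  push_cast
  field_simp
  ring

theorem smoothBlockAvg_eq_sum (u : ℕ → ℝ) (l i : ℕ) :
    smoothBlockAvg u l i = ∑ j ∈ Finset.Ioo (-(l : ℤ)) (l : ℤ),
      triangularWeight l j * u ((i - j : ℤ)).toNat := by
  simp only [smoothBlockAvg, triangularWeight, Finset.mul_sum, mul_assoc]

/-- Discrete summation by transposition: moving the block average from `u` to `a`. -/
theorem sum_mul_smoothBlockAvg (a u : ℕ → ℝ) (N l : ℕ) :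
    ∑ i ∈ Finset.Icc (l + 1) (N - l), smoothBlockAvg u l i * a i =
      ∑ k ∈ Finset.Icc 1 N, u k * ∑ j ∈ Finset.Ioo (-(l : ℤ)) (l : ℤ), triangularWeight l j *
        (if (k + j : ℤ).toNat ∈ Finset.Icc (l + 1) (N - l) then a (k + j : ℤ).toNat else 0) := by
  simp only [smoothBlockAvg_eq_sum, Finset.sum_mul, Finset.mul_sum]
  rw [Finset.sum_comm, Finset.sum_comm (s := Finset.Icc 1 N)]
  refine Finset.sum_congr rfl fun j hj => ?_
  rw [Finset.mem_Ioo] at hj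
  simp only [mul_ite, mul_zero]
  rw [← Finset.sum_filter]
  refine Finset.sum_nbij' (fun i => (i - j : ℤ).toNat) (fun k => (k + j : ℤ).toNat) ?_ ?_ ?_ ?_ ?_
  · intro i hi
    simp only [Finset.mem_filter, Finset.mem_Icc] at hi ⊢
    omega
  · intro k hk
    exact (Finset.mem_filter.1 hk).2
  · intro i hi
    simp only [Finset.mem_Icc] at hi
    omega
  · intro k hk
    simp only [Finset.mem_filter, Finset.mem_Icc] at hk
    omega
  · intro i hi
    simp only [Finset.mem_Icc] at hi
    have h : (((i - j : ℤ).toNat : ℤ) + j).toNat = i := by omega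
    simp only [h]
    ring

/-- The grid cell of width `1 / N` centred at `i / N`. -/
def gridCell (N i : ℕ) : Set ℝ :=
  Set.Icc ((i : ℝ) / N - 1 / (2 * N)) ((i : ℝ) / N + 1 / (2 * N))

theorem measurableSet_gridCell (N i : ℕ) : MeasurableSet (gridCell N i) :=
  measurableSet_Icc

theorem gridCell_subset_unitInterval {N i : ℕ} (hi : 1 ≤ i) (hiN : i + 1 ≤ N) :
    gridCell N i ⊆ Set.Icc 0 1 := by
  have hN : (0 : ℝ) < N := by exact_mod_cast (by omega : 0 < N)
  have h1 : (1 : ℝ) ≤ i := by exact_mod_cast hi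
  have h2 : (i : ℝ) + 1 ≤ N := by exact_mod_cast hiN
  refine Set.Icc_subset_Icc ?_ ?_
  · have : (i : ℝ) / N - 1 / (2 * N) = (i - 1 / 2) / N := by field_simp
    rw [this]
    exact div_nonneg (by linarith) hN.le
  · have : (i : ℝ) / N + 1 / (2 * N) = (i + 1 / 2) / N := by field_simp
    rw [this, div_le_one hN]
    linarith

theorem volume_real_gridCell (N i : ℕ) : volume.real (gridCell N i) = 1 / N := by
  rw [gridCell, Real.volume_real_Icc_of_le]
  · rcases eq_or_ne (N : ℝ) 0 with h | h
    · simp [h]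
    · field_simp
      ring
  · have : (0 : ℝ) ≤ 1 / (2 * N) := by positivity
    linarith

theorem abs_setIntegral_gridCell_sub_le {φ : ℝ → ℝ} (hφ : Continuous φ) {N i : ℕ} {c B : ℝ}
    (h : ∀ x ∈ gridCell N i, |φ x - c| ≤ B) :
    |(∫ x in gridCell N i, φ x) - c / N| ≤ B / N := by
  have hfin : volume (gridCell N i) < ⊤ := measure_Icc_lt_top
  have hint : IntegrableOn φ (gridCell N i) := hφ.integrableOn_Icc
  have hc : (∫ _ in gridCell N i, c) = c / N := by
    rw [setIntegral_const, volume_real_gridCell, smul_eq_mul]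
    ring
  rw [← hc, ← integral_sub hint (integrableOn_const hfin.ne)]
  have := norm_setIntegral_le_of_norm_le_const (μ := volume) (f := fun x => φ x - c) hfin h
  rw [volume_real_gridCell, Real.norm_eq_abs] at this
  calc _ ≤ B * (1 / N) := this
    _ = B / N := by ring

theorem setIntegral_smoothProfile_mul {φ : ℝ → ℝ} (hφ : Continuous φ) (u : ℕ → ℝ) {N l : ℕ}
    (hl : 1 ≤ l) :
    ∫ x in Set.Icc (0 : ℝ) 1, smoothProfile u N l x * φ x =
      ∑ i ∈ Finset.Icc (l + 1) (N - l), smoothBlockAvg u l i * ∫ x in gridCell N i, φ x := by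
  have hpt : ∀ x, smoothProfile u N l x * φ x = ∑ i ∈ Finset.Icc (l + 1) (N - l),
      smoothBlockAvg u l i * (gridCell N i).indicator φ x := by
    intro x
    rw [smoothProfile, Finset.sum_mul]
    refine Finset.sum_congr rfl fun i _ => ?_
    change (gridCell N i).indicator (fun _ => smoothBlockAvg u l i) x * φ x = _
    by_cases hx : x ∈ gridCell N i
    · rw [Set.indicator_of_mem hx, Set.indicator_of_mem hx]
    · rw [Set.indicator_of_notMem hx, Set.indicator_of_notMem hx, zero_mul, mul_zero]
  simp only [hpt]
  rw [integral_finsetSum]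
  · refine Finset.sum_congr rfl fun i hi => ?_
    rw [Finset.mem_Icc] at hi
    rw [integral_const_mul, setIntegral_indicator (measurableSet_gridCell N i),
      Set.inter_eq_self_of_subset_right
        (gridCell_subset_unitInterval (by omega) (by omega))]
  · intro i _
    exact (hφ.integrableOn_Icc.indicator (measurableSet_gridCell N i)).const_mul _

/-- A weighted average with the triangular weights stays within the bound on the averaged values. -/
theorem abs_sum_triangularWeight_mul_sub_le {l : ℕ} (hl : 1 ≤ l) {f : ℤ → ℝ} {c B : ℝ}
    (h : ∀ j ∈ Finset.Ioo (-(l : ℤ)) (l : ℤ), |f j - c| ≤ B) :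
    |∑ j ∈ Finset.Ioo (-(l : ℤ)) (l : ℤ), triangularWeight l j * f j - c| ≤ B := by
  have h1 : ∑ j ∈ Finset.Ioo (-(l : ℤ)) (l : ℤ), triangularWeight l j * f j - c =
      ∑ j ∈ Finset.Ioo (-(l : ℤ)) (l : ℤ), triangularWeight l j * (f j - c) := by
    simp only [mul_sub, Finset.sum_sub_distrib, ← Finset.sum_mul, sum_triangularWeight hl, one_mul]
  rw [h1]
  calc _ ≤ ∑ j ∈ Finset.Ioo (-(l : ℤ)) (l : ℤ), |triangularWeight l j * (f j - c)| :=
        Finset.abs_sum_le_sum_abs _ _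
    _ ≤ ∑ j ∈ Finset.Ioo (-(l : ℤ)) (l : ℤ), triangularWeight l j * B := by
        refine Finset.sum_le_sum fun j hj => ?_
        rw [abs_mul, abs_of_nonneg (triangularWeight_nonneg hj)]
        exact mul_le_mul_of_nonneg_left (h j hj) (triangularWeight_nonneg hj)
    _ = B := by rw [← Finset.sum_mul, sum_triangularWeight hl, one_mul]

/-- The number of grid points within distance about `2l` of the boundary is at most `4l`. -/
theorem card_filter_near_boundary_le (N l : ℕ) :
    #{k ∈ Finset.Icc 1 N | ¬(2 * l ≤ k ∧ k + 2 * l ≤ N + 1)} ≤ 4 * l := by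
  have hsub : {k ∈ Finset.Icc 1 N | ¬(2 * l ≤ k ∧ k + 2 * l ≤ N + 1)} ⊆
      Finset.Ioc 0 (2 * l) ∪ Finset.Ioc (N - 2 * l) N := by
    intro k hk
    simp only [Finset.mem_filter, Finset.mem_Icc, Finset.mem_union, Finset.mem_Ioc] at hk ⊢
    omega
  refine (Finset.card_le_card hsub).trans ((Finset.card_union_le _ _).trans ?_)
  simp only [Nat.card_Ioc]
  omega

/-- For a `C¹` function `φ` there is a constant `C`, depending only on
`sup|φ|` and `sup|φ'|`, such that for all `N ≥ 3`, `1 ≤ l` with `2l+1 ≤ N` and all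
`u ∈ ℝ^N`:
`|∫₀¹ û_N φ dx - (1/N) Σᵢ uᵢ φ(i/N)| ≤ C √(l/N) ((1/N) Σᵢ uᵢ²)^{1/2}`. -/
theorem smoothProfile_replacement_bound (K₀ K₁ : ℝ) :
    ∃ C : ℝ, 0 < C ∧
      ∀ (φ : ℝ → ℝ), ContDiff ℝ 1 φ →
        (∀ x ∈ Set.Icc (0 : ℝ) 1, |φ x| ≤ K₀) →
        (∀ x ∈ Set.Icc (0 : ℝ) 1, |deriv φ x| ≤ K₁) →
      ∀ (N l : ℕ), 3 ≤ N → 1 ≤ l → 2 * l + 1 ≤ N →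
      ∀ (u : ℕ → ℝ),
        |(∫ x in Set.Icc (0 : ℝ) 1, smoothProfile u N l x * φ x) -
            (1 / (N : ℝ)) * ∑ i ∈ Finset.Icc 1 N, u i * φ ((i : ℝ) / N)| ≤
          C * Real.sqrt ((l : ℝ) / N) *
            Real.sqrt ((1 / (N : ℝ)) * ∑ i ∈ Finset.Icc 1 N, (u i) ^ 2) := by
  refine ⟨√(K₁ ^ 2 + 16 * K₀ ^ 2 + 1), by positivity, ?_⟩
  intro φ hφ h0 h1 N l hN hl hlN u
  have hK0 : 0 ≤ K₀ := (abs_nonneg _).trans (h0 0 (by simp))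
  have hK1 : 0 ≤ K₁ := (abs_nonneg _).trans (h1 0 (by simp))
  have hNpos : (0 : ℝ) < N := by exact_mod_cast (by omega : 0 < N)
  have hmem : ∀ k ∈ Finset.Icc 1 N, (k : ℝ) / N ∈ Set.Icc (0 : ℝ) 1 := by
    intro k hk
    rw [Finset.mem_Icc] at hk
    exact ⟨by positivity, (div_le_one hNpos).2 (by exact_mod_cast hk.2)⟩
  set a : ℕ → ℝ := fun i => ∫ x in gridCell N i, φ x
  set d : ℕ → ℝ := fun k => ∑ j ∈ Finset.Ioo (-(l : ℤ)) (l : ℤ), triangularWeight l j *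
    (if (k + j : ℤ).toNat ∈ Finset.Icc (l + 1) (N - l) then a (k + j : ℤ).toNat else 0) -
      φ ((k : ℝ) / N) / N with hd
  have hdiff : (∫ x in Set.Icc (0 : ℝ) 1, smoothProfile u N l x * φ x) -
      (1 / (N : ℝ)) * ∑ i ∈ Finset.Icc 1 N, u i * φ ((i : ℝ) / N) =
      ∑ k ∈ Finset.Icc 1 N, u k * d k := by
    rw [setIntegral_smoothProfile_mul hφ.continuous u hl, sum_mul_smoothBlockAvg a u N l,
      Finset.mul_sum, ← Finset.sum_sub_distrib]
    refine Finset.sum_congr rfl fun k _ => ?_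
    simp only [hd]
    ring
  have hcell : ∀ i ∈ Finset.Icc (l + 1) (N - l), gridCell N i ⊆ Set.Icc 0 1 := by
    intro i hi
    rw [Finset.mem_Icc] at hi
    exact gridCell_subset_unitInterval (by omega) (by omega)
  have hd_le : ∀ k ∈ Finset.Icc 1 N, |d k| ≤ 2 * K₀ / N := by
    intro k hk
    have hk0 := h0 _ (hmem k hk)
    refine abs_sum_triangularWeight_mul_sub_le hl fun j _ => ?_
    split_ifs with hi
    · refine abs_setIntegral_gridCell_sub_le hφ.continuous fun x hx => ?_
      have := h0 x (hcell _ hi hx)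
      exact (abs_sub _ _).trans (by linarith)
    · rw [zero_sub, abs_neg, abs_div, abs_of_pos hNpos]
      gcongr
      linarith
  have hd_le_interior : ∀ k ∈ Finset.Icc 1 N, 2 * l ≤ k ∧ k + 2 * l ≤ N + 1 →
      |d k| ≤ K₁ * (l / N) / N := by
    intro k hk hkl
    refine abs_sum_triangularWeight_mul_sub_le hl fun j hj => ?_
    rw [Finset.mem_Ioo] at hj
    have hi : (k + j : ℤ).toNat ∈ Finset.Icc (l + 1) (N - l) := by
      rw [Finset.mem_Icc]; omega
    rw [if_pos hi]
    refine abs_setIntegral_gridCell_sub_le hφ.continuous fun x hx => ?_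
    have hlip := Convex.norm_image_sub_le_of_norm_deriv_le (𝕜 := ℝ) (f := φ)
      (fun y _ => (hφ.differentiable one_ne_zero) y) h1 (convex_Icc 0 1)
      (hmem k hk) (hcell _ hi hx)
    refine hlip.trans (mul_le_mul_of_nonneg_left ?_ hK1)
    have hcast : (((k + j : ℤ).toNat : ℕ) : ℝ) = k + j := by
      have : (((k + j : ℤ).toNat : ℕ) : ℤ) = k + j := by omega
      exact_mod_cast this
    rw [gridCell, Set.mem_Icc, hcast] at hx
    have hj1 : -(l : ℝ) + 1 ≤ j := by exact_mod_cast (by omega : -(l : ℤ) + 1 ≤ j)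
    have hj2 : (j : ℝ) ≤ l - 1 := by exact_mod_cast (by omega : j ≤ (l : ℤ) - 1)
    have e1 : ((k : ℝ) + j) / N - 1 / (2 * N) = k / N + (j - 1 / 2) / N := by field_simp; ring
    have e2 : ((k : ℝ) + j) / N + 1 / (2 * N) = k / N + (j + 1 / 2) / N := by field_simp; ring
    rw [e1, e2] at hx
    have b1 : -(l : ℝ) / N ≤ (j - 1 / 2) / N := by gcongr; linarith
    have b2 : ((j : ℝ) + 1 / 2) / N ≤ l / N := by gcongr; linarith
    rw [neg_div] at b1
    rw [Real.norm_eq_abs, abs_le]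
    constructor <;> linarith [hx.1, hx.2]
  have hd_sq : ∀ k ∈ Finset.Icc 1 N, d k ^ 2 ≤ (K₁ * (l / N) / N) ^ 2 +
      if ¬(2 * l ≤ k ∧ k + 2 * l ≤ N + 1) then (2 * K₀ / N) ^ 2 else 0 := by
    intro k hk
    rw [← sq_abs]
    by_cases hkl : 2 * l ≤ k ∧ k + 2 * l ≤ N + 1
    · rw [if_neg (not_not.2 hkl), add_zero]
      exact pow_le_pow_left₀ (abs_nonneg _) (hd_le_interior k hk hkl) 2
    · rw [if_pos hkl]
      have := pow_le_pow_left₀ (abs_nonneg _) (hd_le k hk) 2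
      have := sq_nonneg (K₁ * (l / N) / N)
      linarith
  have hsum : ∑ k ∈ Finset.Icc 1 N, d k ^ 2 ≤
      (K₁ ^ 2 + 16 * K₀ ^ 2 + 1) * (l / N) * (1 / N) := by
    have hcard : (#{k ∈ Finset.Icc 1 N | ¬(2 * l ≤ k ∧ k + 2 * l ≤ N + 1)} : ℝ) ≤ 4 * l := by
      exact_mod_cast card_filter_near_boundary_le N l
    have hlN' : (l : ℝ) / N ≤ 1 := (div_le_one hNpos).2 (by exact_mod_cast (by omega : l ≤ N))
    have hl0 : (0 : ℝ) ≤ l / N := by positivity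
    calc _ ≤ N * (K₁ * (l / N) / N) ^ 2 +
          #{k ∈ Finset.Icc 1 N | ¬(2 * l ≤ k ∧ k + 2 * l ≤ N + 1)} * (2 * K₀ / N) ^ 2 := by
          refine (Finset.sum_le_sum hd_sq).trans_eq ?_
          rw [Finset.sum_add_distrib, ← Finset.sum_filter, Finset.sum_const, Finset.sum_const]
          simp
      _ ≤ N * (K₁ * (l / N) / N) ^ 2 + 4 * l * (2 * K₀ / N) ^ 2 := by gcongr
      _ = (K₁ ^ 2 * (l / N) + 16 * K₀ ^ 2) * (l / N) * (1 / N) := by field_simp; ring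
      _ ≤ _ := by
          gcongr ?_ * _ * _
          nlinarith [mul_le_mul_of_nonneg_left hlN' (sq_nonneg K₁)]
  rw [hdiff]
  calc |∑ k ∈ Finset.Icc 1 N, u k * d k|
      ≤ √((∑ k ∈ Finset.Icc 1 N, u k ^ 2) * ∑ k ∈ Finset.Icc 1 N, d k ^ 2) :=
        Real.abs_le_sqrt (Finset.sum_mul_sq_le_sq_mul_sq _ _ _)
    _ ≤ √((K₁ ^ 2 + 16 * K₀ ^ 2 + 1) * (l / N) * ((1 / N) * ∑ k ∈ Finset.Icc 1 N, u k ^ 2)) := by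
        refine Real.sqrt_le_sqrt ?_
        have := mul_le_mul_of_nonneg_left hsum
          (Finset.sum_nonneg fun k (_ : k ∈ Finset.Icc 1 N) => sq_nonneg (u k))
        linarith
    _ = _ := by rw [Real.sqrt_mul (by positivity), Real.sqrt_mul (by positivity)]
end
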